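/- arXiv:2403.19187 — 5 statements merged into one kernel-verified Lean document; each statement's English description precedes it below -/
import Mathlib

section
/- Let n ≥ 1. The term rewriting system Σ_L(n), consisting of rules (2.2), (2.3) and (2.4) for all i : Fin n, is not confluent: there exist terms t, t₁, t₂ with t →* t₁ and t →* t₂ for which no term t' satisfies t₁ →* t' and t₂ →* t'. -/
open FirstOrder FirstOrder.Language

/-- Function symbols of the language of n-loops: one n-ary symbol `f`, one n-ary symbol
`g i` for each `i : Fin n`, and one constant symbol `e`. -/
inductive LFun (n : ℕ) : ℕ → Type
  | f : LFun n n
  | g : Fin n → LFun n n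
  | e : LFun n 0

/-- The language of n-loops. -/
def LLang (n : ℕ) : FirstOrder.Language where
  Functions := LFun n
  Relations := fun _ => Empty

/-- The one-step rewrite relation generated by a set `R` of rewrite rules. -/
inductive Rw {L : FirstOrder.Language} (R : Set (L.Term ℕ × L.Term ℕ)) :
    L.Term ℕ → L.Term ℕ → Prop
  | inst {l r : L.Term ℕ} (hlr : (l, r) ∈ R) (θ : ℕ → L.Term ℕ) :
      Rw R (l.subst θ) (r.subst θ)
  | congr {m : ℕ} (F : L.Functions m) (ts : Fin m → L.Term ℕ) (i : Fin m) {t' : L.Term ℕ} :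
      Rw R (ts i) t' → Rw R (Term.func F ts) (Term.func F (Function.update ts i t'))

/-- The tuple of variables `x_0, ..., x_{n-1}`. -/
def vL (n : ℕ) : Fin n → (LLang n).Term ℕ := fun k => Term.var (k : ℕ)

/-- The constant term `ê`. -/
def ehat (n : ℕ) : (LLang n).Term ℕ := Term.func (LFun.e : LFun n 0) Fin.elim0

/-- Rule (2.2): `f(e, ..., x, ..., e) → x` (the variable at position `i`). -/
def rule22 (n : ℕ) (i : Fin n) : (LLang n).Term ℕ × (LLang n).Term ℕ :=
  (Term.func (LFun.f : LFun n n) (Function.update (fun _ => ehat n) i (Term.var 0)),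
    Term.var 0)

/-- Rule (2.3): `f(x_0, ..., g_i(x_0, ..., x_{n-1}), ..., x_{n-1}) → x_i`. -/
def rule23 (n : ℕ) (i : Fin n) : (LLang n).Term ℕ × (LLang n).Term ℕ :=
  (Term.func (LFun.f : LFun n n) (Function.update (vL n) i (Term.func (LFun.g i) (vL n))),
    vL n i)

/-- Rule (2.4): `g_i(x_0, ..., f(x_0, ..., x_{n-1}), ..., x_{n-1}) → x_i`. -/
def rule24 (n : ℕ) (i : Fin n) : (LLang n).Term ℕ × (LLang n).Term ℕ :=
  (Term.func (LFun.g i) (Function.update (vL n) i (Term.func (LFun.f : LFun n n) (vL n))),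
    vL n i)

/-- Rule (2.9): `g_i(e, ..., x, ..., e) → x` (the variable at position `i`). -/
def rule29 (n : ℕ) (i : Fin n) : (LLang n).Term ℕ × (LLang n).Term ℕ :=
  (Term.func (LFun.g i) (Function.update (fun _ => ehat n) i (Term.var 0)),
    Term.var 0)

/-- Rule (2.7)/(2.8): the argument tuple of `g_i` is `x_k` at positions `k ∉ {i, j}`,
`x_j` at position `i`, and `g_j(x_0, ..., x_{n-1})` at position `j`; it rewrites to `x_i`. -/
def rule2728 (n : ℕ) (i j : Fin n) : (LLang n).Term ℕ × (LLang n).Term ℕ :=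
  (Term.func (LFun.g i)
      (Function.update (Function.update (vL n) i (vL n j)) j (Term.func (LFun.g j) (vL n))),
    vL n i)

/-- Rule (2.10)/(2.11): the argument tuple of `g_i` is `e` at every position except `i`
and `j`, where it is the variable `x`; it rewrites to `ê`. -/
def rule210211 (n : ℕ) (i j : Fin n) : (LLang n).Term ℕ × (LLang n).Term ℕ :=
  (Term.func (LFun.g i)
      (Function.update (Function.update (fun _ => ehat n) i (Term.var 0)) j (Term.var 0)),
    ehat n)

/-- The term rewriting system Σ_L(n): rules (2.2), (2.3) and (2.4) for all `i`. -/
def SigmaL (n : ℕ) : Set ((LLang n).Term ℕ × (LLang n).Term ℕ) :=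
  { p | ∃ i : Fin n, p = rule22 n i ∨ p = rule23 n i ∨ p = rule24 n i }

def isFSym {n : ℕ} : {m : ℕ} → LFun n m → Prop
  | _, LFun.f => True
  | _, LFun.g _ => False
  | _, LFun.e => False

def hasF {n : ℕ} : (LLang n).Term ℕ → Prop
  | Term.var _ => False
  | Term.func F ts => isFSym (n := n) F ∨ ∃ i, hasF (ts i)

theorem hasF_of_rw {n : ℕ} {a b : (LLang n).Term ℕ} (h : Rw (SigmaL n) a b) : hasF a := by
  induction h with
  | inst hlr θ =>
    obtain ⟨i, h | h | h⟩ := hlr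
    · obtain ⟨rfl, rfl⟩ := Prod.mk.inj h
      exact Or.inl trivial
    · obtain ⟨rfl, rfl⟩ := Prod.mk.inj h
      exact Or.inl trivial
    · obtain ⟨rfl, rfl⟩ := Prod.mk.inj h
      refine Or.inr ⟨i, ?_⟩
      have key : ∀ u : (LLang n).Term ℕ, u = Term.func (LFun.f : LFun n n) (vL n) →
          hasF (u.subst θ) := by
        rintro u rfl
        exact Or.inl trivial
      exact key _ (Function.update_self ..)
  | congr F ts i _ ih => exact Or.inr ⟨i, ih⟩

theorem eq_of_rtg {n : ℕ} {a b : (LLang n).Term ℕ} (ha : ¬ hasF a)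
    (h : Relation.ReflTransGen (Rw (SigmaL n)) a b) : a = b := by
  rcases Relation.ReflTransGen.cases_head h with h | ⟨c, hc, _⟩
  · exact h
  · exact absurd (hasF_of_rw hc) ha

theorem ehat_subst (n : ℕ) (θ : ℕ → (LLang n).Term ℕ) : (ehat n).subst θ = ehat n := by
  unfold ehat
  simp only [Term.subst]
  congr 1
  funext k
  exact k.elim0

/-- Lemma 2.4(i): for n ≥ 1, the system Σ_L(n) is not confluent. -/
theorem stmt_15 (n : ℕ) (hn : 1 ≤ n) :
    ∃ t t₁ t₂ : (LLang n).Term ℕ,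
      Relation.ReflTransGen (Rw (SigmaL n)) t t₁ ∧
      Relation.ReflTransGen (Rw (SigmaL n)) t t₂ ∧
      ¬ ∃ t' : (LLang n).Term ℕ,
          Relation.ReflTransGen (Rw (SigmaL n)) t₁ t' ∧
          Relation.ReflTransGen (Rw (SigmaL n)) t₂ t' := by
  let i : Fin n := ⟨0, hn⟩
  let w : Fin n → (LLang n).Term ℕ := Function.update (fun _ => ehat n) i (Term.var 0)
  let s : (LLang n).Term ℕ := Term.func (LFun.g i : LFun n n) w
  refine ⟨Term.func (LFun.f : LFun n n) (Function.update (fun _ => ehat n) i s), s, Term.var 0,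
    Relation.ReflTransGen.single ?_, Relation.ReflTransGen.single ?_, ?_⟩
  · have h := Rw.inst (R := SigmaL n) (l := (rule22 n i).1) (r := (rule22 n i).2)
      ⟨i, Or.inl rfl⟩ (fun _ => s)
    convert h using 1
    rotate_left
    · rfl
    simp only [rule22, Term.subst]
    congr 1
    funext k
    by_cases hk : k = i
    · subst hk; simp [Term.subst]
    · simp [Function.update_of_ne hk, ehat_subst]
  · let θ : ℕ → (LLang n).Term ℕ := fun k => if k = 0 then Term.var 0 else ehat n
    have hw : ∀ k : Fin n, θ k = w k := by
      intro k
      by_cases hk : k = i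
      · subst hk; simp [θ, w, i]
      · have : (k : ℕ) ≠ 0 := fun h => hk (Fin.ext h)
        simp [θ, w, Function.update_of_ne hk, this]
    have h := Rw.inst (R := SigmaL n) (l := (rule23 n i).1) (r := (rule23 n i).2)
      ⟨i, Or.inr (Or.inl rfl)⟩ θ
    convert h using 1
    rotate_left
    · rfl
    simp only [rule23, Term.subst]
    congr 1
    funext k
    by_cases hk : k = i
    · subst hk
      simp only [Function.update_self, Term.subst, s, vL]
      congr 1
      funext k
      exact (hw k).symm
    · rw [Function.update_of_ne hk, Function.update_of_ne hk]
      simp only [vL, Term.subst, hw]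
      simp [w, Function.update_of_ne hk]
  · rintro ⟨t', h1, h2⟩
    have e1 := eq_of_rtg (a := s) ?_ h1
    · have e2 := eq_of_rtg (a := Term.var 0) (fun h => h) h2
      rw [← e2] at e1
      exact Term.noConfusion rfl rfl (heq_of_eq e1)
    · rintro (h | ⟨k, hk⟩)
      · exact h
      · by_cases hki : k = i
        · subst hki
          simp only [w, Function.update_self] at hk
          exact hk
        · simp only [w, Function.update_of_ne hki] at hk
          rcases hk with h | ⟨j, _⟩
          · exact h
          · exact j.elim0
end

section
/- Let n ≥ 2. The term rewriting system obtained as the union of Σ_Q⁺(n) with the rules (2.2) for all i : Fin n is not confluent: there exist terms t, t₁, t₂ with t →* t₁ and t →* t₂ for which no term t' satisfies t₁ →* t' and t₂ →* t'. -/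
open FirstOrder FirstOrder.Language

/-- The term rewriting system Σ_Q⁺(n) (over the language of n-loops): rules (2.3), (2.4)
for all `i`, and rules (2.7)/(2.8) for all `i ≠ j`. -/
def SigmaQplus (n : ℕ) : Set ((LLang n).Term ℕ × (LLang n).Term ℕ) :=
  { p | ∃ i : Fin n, p = rule23 n i ∨ p = rule24 n i } ∪
  { p | ∃ i j : Fin n, i ≠ j ∧ p = rule2728 n i j }

/-- The union of Σ_Q⁺(n) with the rules (2.2) for all `i`. -/
def SigmaQplus22 (n : ℕ) : Set ((LLang n).Term ℕ × (LLang n).Term ℕ) :=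
  SigmaQplus n ∪ { p | ∃ i : Fin n, p = rule22 n i }

/-- The normal form `g_i(e, ..., x, ..., e)`. -/
def nfT (n : ℕ) (i : Fin n) : (LLang n).Term ℕ :=
  Term.func (LFun.g i : LFun n n) (Function.update (fun _ => ehat n) i (Term.var 0))

theorem nf_aux (n : ℕ) (i : Fin n) (a b : (LLang n).Term ℕ) (h : Rw (SigmaQplus22 n) a b) :
    ¬ (a = Term.var 0 ∨ a = ehat n ∨ a = nfT n i) := by
  have hn : n ≠ 0 := fun h => by subst h; exact i.elim0
  induction h with
  | inst hlr θ =>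
    have key : ∀ (F : LFun n n) (ts : Fin n → (LLang n).Term ℕ),
        (Term.func (L := LLang n) F ts = Term.var 0 ∨ Term.func (L := LLang n) F ts = ehat n ∨
          Term.func (L := LLang n) F ts = nfT n i) →
        F = LFun.g i ∧ ts = Function.update (fun _ => ehat n) i (Term.var 0) := by
      intro F ts h
      rcases h with h | h | h
      · cases h
      · unfold ehat at h
        injection h with h1
        exact absurd h1 hn
      · unfold nfT at h
        injection h with h1 h2 h3
        exact ⟨h2, h3⟩
    rcases hlr with (⟨j, hj | hj⟩ | ⟨j, k, hjk, hj⟩) | ⟨j, hj⟩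
    · obtain ⟨rfl, rfl⟩ := Prod.mk.inj hj
      intro h
      have := (key _ _ h).1
      cases this
    · obtain ⟨rfl, rfl⟩ := Prod.mk.inj hj
      intro h
      obtain ⟨h1, h2⟩ := key _ _ h
      cases h1
      have := congrFun h2 i
      simp [Term.subst] at this
    · obtain ⟨rfl, rfl⟩ := Prod.mk.inj hj
      intro h
      obtain ⟨h1, h2⟩ := key _ _ h
      cases h1
      have := congrFun h2 k
      simp [Term.subst, Function.update_of_ne hjk.symm] at this
      unfold ehat at this
      injection this with h1
      exact absurd h1 hn
    · obtain ⟨rfl, rfl⟩ := Prod.mk.inj hj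
      intro h
      have := (key _ _ h).1
      cases this
  | @congr m F ts j t' _ ih =>
    intro h
    rcases h with h | h | h
    · cases h
    · unfold ehat at h
      injection h with h1
      subst h1
      exact j.elim0
    · unfold nfT at h
      injection h with h1 h2 h3
      subst h1
      have h3 := eq_of_heq h3
      subst h3
      apply ih
      by_cases hj : j = i
      · subst hj; simp
      · simp [Function.update_of_ne hj]

theorem nf_star {α : Type*} {r : α → α → Prop} {a b : α} (ha : ∀ c, ¬ r a c)
    (h : Relation.ReflTransGen r a b) : a = b := by
  rcases h.cases_head with h | ⟨c, h, _⟩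
  · exact h
  · exact absurd h (ha c)

/-- Lemma 2.4(ii): for n ≥ 2, the union of Σ_Q⁺(n) with the rules (2.2)
is not confluent. -/
theorem stmt_16 (n : ℕ) (hn : 2 ≤ n) :
    ∃ t t₁ t₂ : (LLang n).Term ℕ,
      Relation.ReflTransGen (Rw (SigmaQplus22 n)) t t₁ ∧
      Relation.ReflTransGen (Rw (SigmaQplus22 n)) t t₂ ∧
      ¬ ∃ t' : (LLang n).Term ℕ,
          Relation.ReflTransGen (Rw (SigmaQplus22 n)) t₁ t' ∧
          Relation.ReflTransGen (Rw (SigmaQplus22 n)) t₂ t' := by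
  let i : Fin n := ⟨0, by omega⟩
  let θ : ℕ → (LLang n).Term ℕ := fun k => if k = 0 then Term.var 0 else ehat n
  have hv : (fun k : Fin n => θ k) = Function.update (fun _ => ehat n) i (Term.var 0) := by
    funext k
    by_cases hk : k = i
    · subst hk; simp [θ, i]
    · have : (k : ℕ) ≠ 0 := fun h => hk (Fin.ext h)
      simp [θ, this, Function.update_of_ne hk]
  have he : (ehat n).subst θ = ehat n := by
    unfold ehat
    simp only [Term.subst]
    congr 1
    funext k
    exact k.elim0
  let u : (LLang n).Term ℕ :=
    Term.func (LFun.f : LFun n n) (Function.update (fun _ => ehat n) i (Term.var 0))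
  let t : (LLang n).Term ℕ :=
    Term.func (LFun.g i : LFun n n) (Function.update (fun _ => ehat n) i u)
  have s1 : Rw (SigmaQplus22 n) t (Term.var 0) := by
    have h := Rw.inst (R := SigmaQplus22 n) (l := (rule24 n i).1) (r := (rule24 n i).2)
      (Or.inl (Or.inl ⟨i, Or.inr rfl⟩)) θ
    have e1 : (rule24 n i).1.subst θ = t := by
      simp only [rule24, Term.subst, t, u]
      congr 1
      funext k
      by_cases hk : k = i
      · subst hk
        simp only [Function.update_self, Term.subst, vL]
        rw [hv]
      · have : (k : ℕ) ≠ 0 := fun h => hk (Fin.ext h)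
        simp [Function.update_of_ne hk, vL, Term.subst, θ, this]
    rw [e1] at h
    exact h
  have s2' : Rw (SigmaQplus22 n) u (Term.var 0) := by
    have h := Rw.inst (R := SigmaQplus22 n) (l := (rule22 n i).1) (r := (rule22 n i).2)
      (Or.inr ⟨i, rfl⟩) θ
    have e1 : (rule22 n i).1.subst θ = u := by
      simp only [rule22, Term.subst, u]
      congr 1
      funext k
      by_cases hk : k = i
      · subst hk
        simp [Term.subst, θ]
      · simp [Function.update_of_ne hk, he]
    rw [e1] at h
    exact h
  have s2 : Rw (SigmaQplus22 n) t (nfT n i) := by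
    have h := Rw.congr (R := SigmaQplus22 n) (LFun.g i : LFun n n)
      (Function.update (fun _ => ehat n) i u) i (t' := Term.var 0) (by simpa using s2')
    rw [Function.update_idem] at h
    exact h
  refine ⟨t, Term.var 0, nfT n i, .single s1, .single s2, ?_⟩
  rintro ⟨t', h1, h2⟩
  have h1 := nf_star (fun c hc => nf_aux n i _ c hc (Or.inl rfl)) h1
  have h2 := nf_star (fun c hc => nf_aux n i _ c hc (Or.inr (Or.inr rfl))) h2
  rw [← h1] at h2
  cases h2
end

section
/- Let n ≥ 2. The term rewriting system consisting of rules (2.2), (2.3), (2.4) and (2.9) for all i : Fin n is not confluent; moreover, the system obtained as the union of Σ_Q⁺(n) with rules (2.2) and (2.9) for all i : Fin n is also not confluent. -/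
open FirstOrder FirstOrder.Language

/-- The system consisting of rules (2.2), (2.3), (2.4) and (2.9) for all `i`. -/
def SigmaL9 (n : ℕ) : Set ((LLang n).Term ℕ × (LLang n).Term ℕ) :=
  { p | ∃ i : Fin n, p = rule22 n i ∨ p = rule23 n i ∨ p = rule24 n i ∨ p = rule29 n i }

/-- The union of Σ_Q⁺(n) with the rules (2.2) and (2.9) for all `i`. -/
def SigmaQplus229 (n : ℕ) : Set ((LLang n).Term ℕ × (LLang n).Term ℕ) :=
  ({ p | ∃ i : Fin n, p = rule23 n i ∨ p = rule24 n i } ∪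
    { p | ∃ i j : Fin n, i ≠ j ∧ p = rule2728 n i j }) ∪
  { p | ∃ i : Fin n, p = rule22 n i ∨ p = rule29 n i }


theorem aux_sub (n : ℕ) : SigmaL9 n ⊆ SigmaQplus229 n := by
  rintro p ⟨i, h | h | h | h⟩
  · exact Or.inr ⟨i, Or.inl h⟩
  · exact Or.inl (Or.inl ⟨i, Or.inl h⟩)
  · exact Or.inl (Or.inl ⟨i, Or.inr h⟩)
  · exact Or.inr ⟨i, Or.inr h⟩

theorem aux_mono {L : FirstOrder.Language} {R S : Set (L.Term ℕ × L.Term ℕ)} (h : R ⊆ S)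
    {a b : L.Term ℕ} (hab : Rw R a b) : Rw S a b := by
  induction hab with
  | inst hlr θ => exact Rw.inst (h hlr) θ
  | congr F ts i _ ih => exact Rw.congr F ts i ih

/-- The arity of the head symbol plus one (zero for variables). -/
def auxAr {n : ℕ} : (LLang n).Term ℕ → ℕ
  | Term.var _ => 0
  | @Term.func _ _ m _ _ => m + 1

/-- Arguments. -/
def auxArg {n : ℕ} : (LLang n).Term ℕ → ℕ → (LLang n).Term ℕ
  | Term.var k, _ => Term.var k
  | @Term.func _ _ m F ts, k => if h : k < m then ts ⟨k, h⟩ else Term.func F ts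

/-- Code of a symbol. -/
def auxC {n m : ℕ} : LFun n m → ℕ
  | LFun.f => 0
  | LFun.g i => i + 2
  | LFun.e => 1

/-- Code of the head symbol. -/
def auxH {n : ℕ} : (LLang n).Term ℕ → ℕ
  | Term.var _ => 0
  | Term.func F _ => auxC F + 1

theorem auxArg_func {n : ℕ} (F : LFun n n) (ts : Fin n → (LLang n).Term ℕ) (k : Fin n) :
    auxArg (Term.func F ts : (LLang n).Term ℕ) k = ts k := by
  simp [auxArg]

theorem aux_rules {n : ℕ} {l r : (LLang n).Term ℕ} (h : (l, r) ∈ SigmaQplus229 n) :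
    (∃ ts, l = Term.func (LFun.f : LFun n n) ts) ∨
    (∃ (i : Fin n) (ts : Fin n → (LLang n).Term ℕ), l = Term.func (LFun.g i : LFun n n) ts ∧
      ((∃ us, ts i = Term.func (LFun.f : LFun n n) us) ∨
       (∃ j us, ts j = Term.func (LFun.g j : LFun n n) us) ∨
       ∀ j, j ≠ i → ts j = ehat n)) := by
  rcases h with (⟨i, h | h⟩ | ⟨i, j, hij, h⟩) | ⟨i, h | h⟩ <;> obtain ⟨rfl, rfl⟩ := Prod.mk.inj h
  · exact Or.inl ⟨_, rfl⟩
  · exact Or.inr ⟨i, _, rfl, Or.inl ⟨_, Function.update_self ..⟩⟩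
  · exact Or.inr ⟨i, _, rfl, Or.inr (Or.inl ⟨j, _, Function.update_self ..⟩)⟩
  · exact Or.inl ⟨_, rfl⟩
  · exact Or.inr ⟨i, _, rfl, Or.inr (Or.inr fun j hj => Function.update_of_ne hj ..)⟩

theorem aux_var {n : ℕ} {a b : (LLang n).Term ℕ} (h : Rw (SigmaQplus229 n) a b) :
    auxH a ≠ 0 := by
  cases h with
  | inst hlr θ =>
    rcases aux_rules hlr with ⟨ts, rfl⟩ | ⟨i, ts, rfl, -⟩ <;> simp [auxH, Term.subst]
  | congr F ts i h => simp [auxH]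

theorem aux_ar {n : ℕ} (hn : 2 ≤ n) {a b : (LLang n).Term ℕ} (h : Rw (SigmaQplus229 n) a b) :
    auxAr a ≠ 1 := by
  cases h with
  | inst hlr θ =>
    rcases aux_rules hlr with ⟨ts, rfl⟩ | ⟨i, ts, rfl, -⟩ <;> simp [auxAr, Term.subst] <;> omega
  | @congr m F ts i _ h => have := i.2; simp [auxAr]; omega

/-- The bad normal form. -/
def auxT (n : ℕ) (i j : Fin n) : (LLang n).Term ℕ :=
  Term.func (LFun.g i : LFun n n)
    (fun k => if k = i ∨ k = j then Term.var 0 else ehat n)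

theorem auxT_arg {n : ℕ} (i j k : Fin n) :
    auxArg (auxT n i j) k = if k = i ∨ k = j then Term.var 0 else ehat n := by
  rw [auxT, auxArg_func]

theorem auxT_H {n : ℕ} (i j k : Fin n) :
    auxH (auxArg (auxT n i j) k) = 0 ∨ auxH (auxArg (auxT n i j) k) = 2 := by
  rw [auxT_arg]; split_ifs <;> simp [auxH, ehat, auxC]

theorem auxT_normal {n : ℕ} (hn : 2 ≤ n) {i j : Fin n} (hij : i ≠ j) {a b : (LLang n).Term ℕ}
    (h : Rw (SigmaQplus229 n) a b) (ha : a = auxT n i j) : False := by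
  cases h with
  | inst hlr θ =>
    rcases aux_rules hlr with ⟨ts, rfl⟩ | ⟨i', ts, rfl, H⟩
    · have := congrArg auxH ha
      simp [auxH, auxT, auxC, Term.subst] at this
    · have h1 := congrArg auxH ha
      simp [auxH, auxT, auxC, Term.subst] at h1
      have h1 : i' = i := Fin.ext h1
      subst h1
      have key : ∀ k : Fin n, (ts k).subst θ = auxArg (auxT n i' j) k := by
        intro k
        rw [← ha]
        exact (auxArg_func (LFun.g i') (fun k => (ts k).subst θ) k).symm
      rcases H with ⟨us, hu⟩ | ⟨k, us, hu⟩ | H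
      · have := auxT_H i' j i'
        rw [← key, hu] at this
        simp [auxH, auxC, Term.subst] at this
      · have := auxT_H i' j k
        rw [← key, hu] at this
        simp [auxH, auxC, Term.subst] at this
      · have := key j
        rw [H j hij.symm, auxT_arg] at this
        have := congrArg auxH this
        simp [auxH, ehat, Term.subst] at this
  | @congr m F ts k t' h =>
    have h1 := congrArg auxAr ha
    simp [auxAr, auxT] at h1
    subst h1
    have key : ts k = auxArg (auxT m i j) k := by
      rw [← ha]
      exact (auxArg_func _ _ k).symm
    rw [auxT_arg] at key
    split_ifs at key
    · exact aux_var h (by rw [key]; rfl)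
    · exact aux_ar hn h (by rw [key]; rfl)

theorem aux_star {n : ℕ} {R : Set ((LLang n).Term ℕ × (LLang n).Term ℕ)}
    {a b : (LLang n).Term ℕ} (hR : R ⊆ SigmaQplus229 n)
    (h : Relation.ReflTransGen (Rw R) a b) (ha : ∀ c, ¬ Rw (SigmaQplus229 n) a c) : b = a := by
  rcases Relation.ReflTransGen.cases_head h with h | ⟨c, hc, -⟩
  · exact h.symm
  · exact (ha c (aux_mono hR hc)).elim

theorem aux_main (n : ℕ) (hn : 2 ≤ n) (R : Set ((LLang n).Term ℕ × (LLang n).Term ℕ))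
    (h1 : SigmaL9 n ⊆ R) (hR : R ⊆ SigmaQplus229 n) :
    ∃ t t₁ t₂ : (LLang n).Term ℕ,
      Relation.ReflTransGen (Rw R) t t₁ ∧ Relation.ReflTransGen (Rw R) t t₂ ∧
      ¬ ∃ t' : (LLang n).Term ℕ,
          Relation.ReflTransGen (Rw R) t₁ t' ∧ Relation.ReflTransGen (Rw R) t₂ t' := by
  let i : Fin n := ⟨0, by omega⟩
  let j : Fin n := ⟨1, by omega⟩
  have hij : i ≠ j := by simp [i, j]
  let u : Fin n → (LLang n).Term ℕ := Function.update (fun _ => ehat n) j (Term.var 0)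
  have he : ∀ θ : ℕ → (LLang n).Term ℕ, (ehat n).subst θ = ehat n := by
    intro θ
    simp only [ehat, Term.subst]
    congr 1
    funext k
    exact k.elim0
  refine ⟨Term.func (LFun.g i : LFun n n)
    (Function.update u i (Term.func (LFun.f : LFun n n) u)), ehat n, auxT n i j, ?_, ?_, ?_⟩
  · apply Relation.ReflTransGen.single
    have := Rw.inst (R := R) (l := (rule24 n i).1) (r := (rule24 n i).2)
      (h1 ⟨i, Or.inr (Or.inr (Or.inl rfl))⟩)
      (fun k => if k = 1 then Term.var 0 else ehat n)
    have hu : ∀ k : Fin n, (vL n k).subst (fun k => if k = 1 then Term.var 0 else ehat n) = u k := by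
      intro k
      by_cases hk : k = j
      · subst hk; simp [vL, u, Term.subst, j]
      · have : (k : ℕ) ≠ 1 := fun h => hk (Fin.ext h)
        simp [vL, u, Term.subst, this, hk]
    convert this using 1
    · simp only [rule24, Term.subst]
      congr 1
      funext k
      by_cases hk : k = i
      · subst hk; simp [Term.subst, hu]
      · simp [hk, hu]
    · simp [rule24, hu, u, hij]
  · apply Relation.ReflTransGen.single
    have hf : Rw R (Term.func (LFun.f : LFun n n) u) (Term.var 0) := by
      have := Rw.inst (R := R) (l := (rule22 n j).1) (r := (rule22 n j).2)
        (h1 ⟨j, Or.inl rfl⟩) Term.var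
      convert this using 1
      swap
      · rfl
      simp only [rule22, Term.subst]
      congr 1
      funext k
      by_cases hk : k = j
      · subst hk; simp [Term.subst, u]
      · simp [hk, he, u]
    have := Rw.congr (R := R) (L := LLang n) (LFun.g i : LFun n n)
      (Function.update u i (Term.func (LFun.f : LFun n n) u)) i (t' := Term.var 0)
      (by rw [Function.update_self]; exact hf)
    convert this using 1
    rw [auxT]
    congr 1
    funext k
    by_cases hk : k = i
    · subst hk; simp
    · by_cases hk' : k = j
      · subst hk'; simp [hk, u]
      · simp [hk, hk', u]
  · rintro ⟨t', ha, hb⟩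
    have e1 := aux_star hR ha (fun c hc => aux_ar hn hc rfl)
    have e2 := aux_star hR hb (fun c hc => auxT_normal hn hij hc rfl)
    have := congrArg auxH (e1.symm.trans e2)
    simp [auxH, ehat, auxT, auxC] at this

/-- Lemma 2.5: for n ≥ 2, the system of rules (2.2)-(2.4), (2.9) is not
confluent, and neither is the union of Σ_Q⁺(n) with the rules (2.2) and (2.9). -/
theorem stmt_17 (n : ℕ) (hn : 2 ≤ n) :
    (∃ t t₁ t₂ : (LLang n).Term ℕ,
      Relation.ReflTransGen (Rw (SigmaL9 n)) t t₁ ∧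
      Relation.ReflTransGen (Rw (SigmaL9 n)) t t₂ ∧
      ¬ ∃ t' : (LLang n).Term ℕ,
          Relation.ReflTransGen (Rw (SigmaL9 n)) t₁ t' ∧
          Relation.ReflTransGen (Rw (SigmaL9 n)) t₂ t') ∧
    (∃ t t₁ t₂ : (LLang n).Term ℕ,
      Relation.ReflTransGen (Rw (SigmaQplus229 n)) t t₁ ∧
      Relation.ReflTransGen (Rw (SigmaQplus229 n)) t t₂ ∧
      ¬ ∃ t' : (LLang n).Term ℕ,
          Relation.ReflTransGen (Rw (SigmaQplus229 n)) t₁ t' ∧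
          Relation.ReflTransGen (Rw (SigmaQplus229 n)) t₂ t') := by
  exact ⟨aux_main n hn _ subset_rfl (aux_sub n), aux_main n hn _ (aux_sub n) subset_rfl⟩
end

section
/- For n = 1, the term rewriting system consisting of the four rules f(x) → x, f(g(x)) → x, g(f(x)) → x and g(x) → x is confluent: for all terms t, t₁, t₂ with t →* t₁ and t →* t₂ there exists t' with t₁ →* t' and t₂ →* t'. -/
open FirstOrder FirstOrder.Language

/-- Rule (2.2) for n = 1: `f(x) → x`. -/
def rule22one : (LLang 1).Term ℕ × (LLang 1).Term ℕ :=
  (Term.func (LFun.f : LFun 1 1) (fun _ => Term.var 0), Term.var 0)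

/-- Rule (2.3) for n = 1: `f(g(x)) → x`. -/
def rule23one : (LLang 1).Term ℕ × (LLang 1).Term ℕ :=
  (Term.func (LFun.f : LFun 1 1) (fun _ => Term.func (LFun.g 0) (fun _ => Term.var 0)),
    Term.var 0)

/-- Rule (2.4) for n = 1: `g(f(x)) → x`. -/
def rule24one : (LLang 1).Term ℕ × (LLang 1).Term ℕ :=
  (Term.func (LFun.g (0 : Fin 1)) (fun _ => Term.func (LFun.f : LFun 1 1) (fun _ => Term.var 0)),
    Term.var 0)

/-- Rule (2.9) for n = 1: `g(x) → x`. -/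
def rule29one : (LLang 1).Term ℕ × (LLang 1).Term ℕ :=
  (Term.func (LFun.g (0 : Fin 1)) (fun _ => Term.var 0), Term.var 0)

/-- The term rewriting system for 1-loops: rules (2.2), (2.3), (2.4), (2.9) for n = 1. -/
def SigmaL1 : Set ((LLang 1).Term ℕ × (LLang 1).Term ℕ) :=
  {rule22one, rule23one, rule24one, rule29one}

/-- Strip all unary symbols. -/
def coreT : (LLang 1).Term ℕ → (LLang 1).Term ℕ
  | .var x => .var x
  | @Term.func _ _ 0 F ts => Term.func F ts
  | @Term.func _ _ (_ + 1) _ ts => coreT (ts 0)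

theorem LFun_arity {m : ℕ} (F : LFun 1 m) : m = 0 ∨ m = 1 := by
  cases F <;> simp

theorem coreT_rw {t t' : (LLang 1).Term ℕ} (h : Rw SigmaL1 t t') : coreT t = coreT t' := by
  induction h with
  | inst hlr θ =>
    simp only [SigmaL1, Set.mem_insert_iff, Set.mem_singleton_iff, rule22one, rule23one,
      rule24one, rule29one, Prod.mk.injEq] at hlr
    rcases hlr with ⟨rfl, rfl⟩ | ⟨rfl, rfl⟩ | ⟨rfl, rfl⟩ | ⟨rfl, rfl⟩ <;> rfl
  | @congr m F ts i t' _ ih =>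
    rcases LFun_arity F with rfl | rfl
    · exact i.elim0
    · obtain rfl : i = 0 := Subsingleton.elim _ _
      simpa [coreT] using ih

theorem coreT_star {t t' : (LLang 1).Term ℕ} (h : Relation.ReflTransGen (Rw SigmaL1) t t') :
    coreT t = coreT t' := by
  induction h with
  | refl => rfl
  | tail _ h ih => exact ih.trans (coreT_rw h)

theorem step_f (ts : Fin 1 → (LLang 1).Term ℕ) :
    Rw SigmaL1 (Term.func (LFun.f : LFun 1 1) ts) (ts 0) := by
  have h := Rw.inst (R := SigmaL1) (l := rule22one.1) (r := rule22one.2)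
    (by simp [SigmaL1]) (fun _ => ts 0)
  have e : ts = fun _ => ts 0 := by
    funext i; rw [Subsingleton.elim i 0]
  rw [e]; exact h

theorem step_g (ts : Fin 1 → (LLang 1).Term ℕ) :
    Rw SigmaL1 (Term.func (LFun.g 0 : LFun 1 1) ts) (ts 0) := by
  have h := Rw.inst (R := SigmaL1) (l := rule29one.1) (r := rule29one.2)
    (by simp [SigmaL1]) (fun _ => ts 0)
  have e : ts = fun _ => ts 0 := by
    funext i; rw [Subsingleton.elim i 0]
  rw [e]; exact h

theorem to_coreT (t : (LLang 1).Term ℕ) : Relation.ReflTransGen (Rw SigmaL1) t (coreT t) := by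
  induction t with
  | var x => exact .refl
  | @func m F ts ih =>
    change LFun 1 m at F
    cases F with
    | f => exact .head (step_f ts) (ih 0)
    | g j =>
      obtain rfl : j = 0 := Subsingleton.elim _ _
      exact .head (step_g ts) (ih 0)
    | e => exact .refl

/-- Lemma 2.5, 'if': the system of rules `f(x) → x`, `f(g(x)) → x`,
`g(f(x)) → x`, `g(x) → x` is confluent. -/
theorem stmt_18 :
    ∀ t t₁ t₂ : (LLang 1).Term ℕ,
      Relation.ReflTransGen (Rw SigmaL1) t t₁ →
      Relation.ReflTransGen (Rw SigmaL1) t t₂ →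
      ∃ t' : (LLang 1).Term ℕ,
        Relation.ReflTransGen (Rw SigmaL1) t₁ t' ∧
        Relation.ReflTransGen (Rw SigmaL1) t₂ t' := by
  intro t t₁ t₂ h₁ h₂
  refine ⟨coreT t, ?_, ?_⟩
  · rw [coreT_star h₁]; exact to_coreT t₁
  · rw [coreT_star h₂]; exact to_coreT t₂
end

section
/- Let n ≥ 2. The term rewriting system Σ_L⁺(n), consisting of rules (2.2), (2.3), (2.4) and (2.9) for all i : Fin n, rules (2.7)/(2.8) for all i ≠ j, and rules (2.10)/(2.11) for all i ≠ j, is confluent: for all terms t, t₁, t₂ with t →* t₁ and t →* t₂ there exists t' with t₁ →* t' and t₂ →* t'. -/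
open FirstOrder FirstOrder.Language

/-- The term rewriting system Σ_L⁺(n): rules (2.2), (2.3), (2.4) and (2.9) for all `i`,
and rules (2.7)/(2.8) and (2.10)/(2.11) for all `i ≠ j`. -/
def SigmaLplus (n : ℕ) : Set ((LLang n).Term ℕ × (LLang n).Term ℕ) :=
  { p | ∃ i : Fin n, p = rule22 n i ∨ p = rule23 n i ∨ p = rule24 n i ∨ p = rule29 n i } ∪
  { p | ∃ i j : Fin n, i ≠ j ∧ (p = rule2728 n i j ∨ p = rule210211 n i j) }

namespace LoopConf

inductive T (n : ℕ) : Type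
  | var : ℕ → T n
  | f : (Fin n → T n) → T n
  | g : Fin n → (Fin n → T n) → T n
  | e : T n

variable {n : ℕ}

def sz : T n → ℕ
  | .var _ => 0
  | .f a => (∑ k, sz (a k)) + 1
  | .g _ a => (∑ k, sz (a k)) + 1
  | .e => 0

lemma sz_f (a : Fin n → T n) (k : Fin n) : sz (a k) < sz (T.f a) := by
  simp only [sz]
  have := Finset.single_le_sum (f := fun k => sz (a k)) (fun _ _ => Nat.zero_le _) (Finset.mem_univ k)
  omega

lemma sz_g (i : Fin n) (a : Fin n → T n) (k : Fin n) : sz (a k) < sz (T.g i a) := by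
  simp only [sz]
  have := Finset.single_le_sum (f := fun k => sz (a k)) (fun _ _ => Nat.zero_le _) (Finset.mem_univ k)
  omega

inductive RF (a : Fin n → T n) : T n → Prop
  | A (i : Fin n) (h : ∀ k, k ≠ i → a k = T.e) : RF a (a i)
  | B (i : Fin n) (b : Fin n → T n) (h : ∀ k, k ≠ i → a k = b k) (hi : a i = T.g i b) : RF a (b i)

inductive RG (i : Fin n) (a : Fin n → T n) : T n → Prop
  | C (b : Fin n → T n) (h : ∀ k, k ≠ i → a k = b k) (hi : a i = T.f b) : RG i a (b i)
  | D (h : ∀ k, k ≠ i → a k = T.e) : RG i a (a i)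
  | E (j : Fin n) (hj : j ≠ i) (b : Fin n → T n) (h : ∀ k, k ≠ i → k ≠ j → a k = b k)
      (hi : a i = b j) (hjj : a j = T.g j b) : RG i a (b i)
  | F (j : Fin n) (hj : j ≠ i) (h : ∀ k, k ≠ i → k ≠ j → a k = T.e) (hi : a i = a j) : RG i a T.e

def N : T n → Prop
  | .var _ => True
  | .f a => (∀ k, N (a k)) ∧ ∀ r, ¬ RF a r
  | .g i a => (∀ k, N (a k)) ∧ ∀ r, ¬ RG i a r
  | .e => True

open Classical in
noncomputable def redF (a : Fin n → T n) : T n := if h : ∃ r, RF a r then h.choose else T.f a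
open Classical in
noncomputable def redG (i : Fin n) (a : Fin n → T n) : T n :=
  if h : ∃ r, RG i a r then h.choose else T.g i a

lemma redF_cases (a : Fin n → T n) : RF a (redF a) ∨ ((∀ r, ¬ RF a r) ∧ redF a = T.f a) := by
  unfold redF
  split_ifs with h
  · exact .inl h.choose_spec
  · exact .inr ⟨by simpa using h, rfl⟩

lemma redG_cases (i : Fin n) (a : Fin n → T n) :
    RG i a (redG i a) ∨ ((∀ r, ¬ RG i a r) ∧ redG i a = T.g i a) := by
  unfold redG
  split_ifs with h
  · exact .inl h.choose_spec
  · exact .inr ⟨by simpa using h, rfl⟩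

lemma RF_N {a : Fin n → T n} (ha : ∀ k, N (a k)) {r : T n} (h : RF a r) : N r := by
  cases h with
  | A i h => exact ha i
  | B i b h hi => have := ha i; rw [hi] at this; exact this.1 i

lemma RG_N {i : Fin n} {a : Fin n → T n} (ha : ∀ k, N (a k)) {r : T n} (h : RG i a r) : N r := by
  cases h with
  | C b h hi => have := ha i; rw [hi] at this; exact this.1 i
  | D h => exact ha i
  | E j hj b h hi hjj => have := ha j; rw [hjj] at this; exact this.1 i
  | F => trivial

lemma redF_N {a : Fin n → T n} (ha : ∀ k, N (a k)) : N (redF a) := by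
  rcases redF_cases a with h | ⟨h, h'⟩
  · exact RF_N ha h
  · rw [h']; exact ⟨ha, h⟩

lemma redG_N {i : Fin n} {a : Fin n → T n} (ha : ∀ k, N (a k)) : N (redG i a) := by
  rcases redG_cases i a with h | ⟨h, h'⟩
  · exact RG_N ha h
  · rw [h']; exact ⟨ha, h⟩

lemma RF_det {a : Fin n → T n} (ha : ∀ k, N (a k)) {r s : T n} (h : RF a r) (h' : RF a s) :
    r = s := by
  have AB : ∀ i, (∀ k, k ≠ i → a k = T.e) → ∀ j b, (∀ k, k ≠ j → a k = b k) → a j = T.g j b →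
      False := by
    intro i h j b hb hj
    by_cases hij : j = i
    · subst hij
      have h1 := ha j
      rw [hj] at h1
      exact h1.2 _ (RG.D fun k hk => by rw [← hb k hk, h k hk])
    · have := h j hij
      rw [hj] at this; cases this
  cases h with
  | A i h =>
    cases h' with
    | A j h' =>
      by_cases hij : i = j
      · rw [hij]
      · rw [h' i hij, h j (Ne.symm hij)]
    | B j b hb hj => exact (AB i h j b hb hj).elim
  | B i b hb hi =>
    cases h' with
    | A j h' => exact (AB j h' i b hb hi).elim
    | B j c hc hj =>
      by_cases hij : i = j
      · subst hij
        rw [hi] at hj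
        injection hj with _ h2
        rw [h2]
      · exfalso
        have h1 := hb j (Ne.symm hij)
        have h2 := hc i hij
        have h3 := sz_g i b j
        have h4 := sz_g j c i
        rw [← h1, hj, ← hi] at h3
        rw [← h2, ← hj] at h4
        rw [← hj] at h3
        omega

lemma RG_det {i : Fin n} {a : Fin n → T n} (ha : ∀ k, N (a k)) {r s : T n}
    (h : RG i a r) (h' : RG i a s) : r = s := by
  have CD : ∀ b, (∀ k, k ≠ i → a k = b k) → a i = T.f b → (∀ k, k ≠ i → a k = T.e) → False := by
    intro b hb hi h
    have h1 := ha i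
    rw [hi] at h1
    exact h1.2 _ (RF.A i fun k hk => by rw [← hb k hk, h k hk])
  have CE : ∀ b, (∀ k, k ≠ i → a k = b k) → a i = T.f b → ∀ j, j ≠ i → ∀ c : Fin n → T n,
      a i = c j → a j = T.g j c → False := by
    intro b hb hi j hj c h1 h2
    have h3 := sz_f b j
    have h4 := sz_g j c j
    rw [← hb j hj, ← hi] at h3
    rw [← h1, ← h2] at h4
    omega
  have CF : ∀ b, (∀ k, k ≠ i → a k = b k) → a i = T.f b → ∀ j, j ≠ i → a i = a j → False := by
    intro b hb hi j hj h1
    have h3 := sz_f b j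
    rw [← hb j hj, ← hi, h1] at h3
    omega
  have DE : (∀ k, k ≠ i → a k = T.e) → ∀ j, j ≠ i → ∀ c : Fin n → T n, a j = T.g j c → False := by
    intro h j hj c h1
    rw [h j hj] at h1; cases h1
  have EF : ∀ j, j ≠ i → ∀ c : Fin n → T n, a i = c j → a j = T.g j c → ∀ j', j' ≠ i →
      (∀ k, k ≠ i → k ≠ j' → a k = T.e) → a i = a j' → False := by
    intro j hj c h1 h2 j' hj' h h3
    by_cases hjj : j = j'
    · subst hjj
      have h4 := sz_g j c j
      rw [← h1, ← h2, h3] at h4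
      omega
    · rw [h j hj hjj] at h2; cases h2
  cases h with
  | C b hb hi =>
    cases h' with
    | C c hc hi' =>
      rw [hi] at hi'
      injection hi' with h2
      rw [h2]
    | D h => exact (CD b hb hi h).elim
    | E j hj c h h1 h2 => exact (CE b hb hi j hj c h1 h2).elim
    | F j hj h h1 => exact (CF b hb hi j hj h1).elim
  | D h =>
    cases h' with
    | C b hb hi => exact (CD b hb hi h).elim
    | D h => rfl
    | E j hj c h' h1 h2 => exact (DE h j hj c h2).elim
    | F j hj h' h1 => rw [h1, h j hj]
  | E j hj c h h1 h2 =>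
    cases h' with
    | C b hb hi => exact (CE b hb hi j hj c h1 h2).elim
    | D h => exact (DE h j hj c h2).elim
    | E k hk d h' h3 h4 =>
      by_cases hjk : j = k
      · subst hjk
        rw [h2] at h4
        injection h4 with _ h5
        rw [h5]
      · exfalso
        have h5 := sz_g j c k
        have h6 := sz_g k d j
        rw [← h k hk (Ne.symm hjk), ← h2] at h5
        rw [← h' j hj hjk, ← h4] at h6
        omega
    | F j' hj' h' h3 => exact (EF j hj c h1 h2 j' hj' h' h3).elim
  | F j hj h h1 =>
    cases h' with
    | C b hb hi => exact (CF b hb hi j hj h1).elim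
    | D h => rw [h1, h j hj]
    | E k hk c h' h3 h4 => exact (EF k hk c h3 h4 j hj h h1).elim
    | F => rfl

lemma redF_eq {a : Fin n → T n} (ha : ∀ k, N (a k)) {r : T n} (h : RF a r) : redF a = r := by
  rcases redF_cases a with h' | ⟨h', _⟩
  · exact RF_det ha h' h
  · exact (h' _ h).elim

lemma redG_eq {i : Fin n} {a : Fin n → T n} (ha : ∀ k, N (a k)) {r : T n} (h : RG i a r) :
    redG i a = r := by
  rcases redG_cases i a with h' | ⟨h', _⟩
  · exact RG_det ha h' h
  · exact (h' _ h).elim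

lemma redG_norm {i : Fin n} {a : Fin n → T n} (h : N (T.g i a)) : redG i a = T.g i a := by
  rcases redG_cases i a with h' | ⟨_, h'⟩
  · exact (h.2 _ h').elim
  · exact h'

lemma redF_norm {a : Fin n → T n} (h : N (T.f a)) : redF a = T.f a := by
  rcases redF_cases a with h' | ⟨_, h'⟩
  · exact (h.2 _ h').elim
  · exact h'

lemma N_update {a : Fin n → T n} (ha : ∀ k, N (a k)) (i : Fin n) {t : T n} (ht : N t) :
    ∀ k, N (Function.update a i t k) := by
  intro k
  by_cases h : k = i
  · subst h; simpa using ht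
  · simpa [h] using ha k

lemma N_e : N (T.e : T n) := by simp only [N]

lemma eqA (i : Fin n) {t : T n} (ht : N t) :
    redF (Function.update (fun _ => T.e) i t) = t := by
  have := RF.A (a := Function.update (fun _ => T.e) i t) i (fun k hk => by simp [hk])
  rw [Function.update_self] at this
  exact redF_eq (N_update (fun _ => N_e) i ht) this

lemma eqD (i : Fin n) {t : T n} (ht : N t) :
    redG i (Function.update (fun _ => T.e) i t) = t := by
  have := RG.D (i := i) (a := Function.update (fun _ => T.e) i t) (fun k hk => by simp [hk])
  rw [Function.update_self] at this
  exact redG_eq (N_update (fun _ => N_e) i ht) this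

lemma eqF (i j : Fin n) (hij : i ≠ j) {t : T n} (ht : N t) :
    redG i (Function.update (Function.update (fun _ => T.e) i t) j t) = T.e :=
  redG_eq (N_update (N_update (fun _ => N_e) i ht) j ht)
    (RG.F j hij.symm (fun k h1 h2 => by simp [h1, h2]) (by simp [hij]))

lemma eqB (i : Fin n) {a : Fin n → T n} (ha : ∀ k, N (a k)) :
    redF (Function.update a i (redG i a)) = a i := by
  have hN := N_update ha i (redG_N (i := i) ha)
  rcases redG_cases i a with h | ⟨h, h'⟩
  · generalize redG i a = r at *
    cases h with
    | C b h hi =>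
      have : Function.update a i (b i) = b := by
        ext k; by_cases hk : k = i
        · subst hk; simp
        · simp [hk, h k hk]
      rw [this, hi]
      have h2 := ha i
      rw [hi] at h2
      exact redF_norm h2
    | D h =>
      refine redF_eq hN ?_
      rw [Function.update_eq_self]
      exact RF.A i h
    | E j hj b h hi hjj =>
      refine redF_eq hN ?_
      rw [hi]
      refine RF.B j b (fun k hk => ?_) (by simp [hj, hjj])
      by_cases hki : k = i
      · subst hki; simp
      · simp [hki, h k hki hk]
    | F j hj h hi =>
      refine redF_eq hN ?_
      have : a i = Function.update a i T.e j := by simp [hj, hi]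
      rw [this]
      refine RF.A j fun k hk => ?_
      by_cases hki : k = i
      · subst hki; simp
      · simp [hki, h k hki hk]
  · refine redF_eq hN ?_
    rw [h']
    exact RF.B i a (fun k hk => by simp [hk]) (by simp)

lemma eqC (i : Fin n) {a : Fin n → T n} (ha : ∀ k, N (a k)) :
    redG i (Function.update a i (redF a)) = a i := by
  have hN := N_update ha i (redF_N ha)
  rcases redF_cases a with h | ⟨h, h'⟩
  · generalize redF a = r at *
    cases h with
    | A j h =>
      refine redG_eq hN ?_
      by_cases hji : j = i
      · subst hji
        rw [Function.update_eq_self]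
        exact RG.D h
      · rw [h i (Ne.symm hji)]
        exact RG.F j hji (fun k h1 h2 => by simp [h1, h k h2]) (by simp [hji])
    | B j b h hj =>
      by_cases hji : j = i
      · subst hji
        have : Function.update a j (b j) = b := by
          ext k; by_cases hk : k = j
          · subst hk; simp
          · simp [hk, h k hk]
        rw [this, hj]
        have h2 := ha j
        rw [hj] at h2
        exact redG_norm h2
      · refine redG_eq hN ?_
        rw [h i (Ne.symm hji)]
        exact RG.E j hji b (fun k h1 h2 => by simp [h1, h k h2]) (by simp) (by simp [hji, hj])
  · refine redG_eq hN ?_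
    rw [h']
    exact RG.C a (fun k hk => by simp [hk]) (by simp)

lemma eqE (i j : Fin n) (hij : i ≠ j) {a : Fin n → T n} (ha : ∀ k, N (a k)) :
    redG i (Function.update (Function.update a i (a j)) j (redG j a)) = a i := by
  have hN := N_update (N_update ha i (ha j)) j (redG_N (i := j) ha)
  rcases redG_cases j a with h | ⟨h, h'⟩
  · generalize redG j a = r at *
    cases h with
    | C b h hj =>
      refine redG_eq hN ?_
      rw [h i hij]
      refine RG.C b (fun k hk => ?_) (by simp [hij, hj])
      by_cases hkj : k = j
      · subst hkj; simp
      · simp [hk, hkj, h k hkj]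
    | D h =>
      refine redG_eq hN ?_
      rw [h i hij]
      exact RG.F j hij.symm (fun k h1 h2 => by simp [h1, h2, h k h2]) (by simp [hij])
    | E k hk b h hj hkk =>
      by_cases hki : k = i
      · subst hki
        have : Function.update (Function.update a k (a j)) j (b j) = b := by
          ext l; by_cases hl : l = j
          · subst hl; simp
          · by_cases hl' : l = k
            · subst hl'; simp [hl, hj]
            · simp [hl, hl', h l hl hl']
        rw [this, hkk]
        have h2 := ha k
        rw [hkk] at h2
        exact redG_norm h2
      · refine redG_eq hN ?_
        rw [h i hij (Ne.symm hki)]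
        refine RG.E k hki b (fun l h1 h2 => ?_) (by simp [hij, hj]) (by simp [hk, hki, hkk])
        by_cases hl : l = j
        · subst hl; simp
        · simp [hl, h1, h l hl h2]
    | F k hk h hj =>
      refine redG_eq hN ?_
      by_cases hki : k = i
      · subst hki
        have : a k = Function.update (Function.update a k (a j)) j T.e k := by simp [hij, hj]
        rw [this]
        refine RG.D (fun l h1 => ?_)
        by_cases hl : l = j
        · subst hl; simp
        · simp [hl, h1, h l hl h1]
      · rw [h i hij (Ne.symm hki)]
        refine RG.F k hki (fun l h1 h2 => ?_) (by simp [hij, hk, hki, hj])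
        by_cases hl : l = j
        · subst hl; simp
        · simp [hl, h1, h l hl h2]
  · refine redG_eq hN ?_
    rw [h']
    exact RG.E j hij.symm a (fun k h1 h2 => by simp [h1, h2]) (by simp [hij]) (by simp)

noncomputable def app : {m : ℕ} → LFun n m → (Fin m → T n) → T n
  | _, .f, a => redF a
  | _, .g i, a => redG i a
  | _, .e, _ => T.e

noncomputable def nf : (LLang n).Term ℕ → T n
  | .var k => T.var k
  | .func F ts => app (n := n) F (fun k => nf (ts k))

lemma nf_N : ∀ t : (LLang n).Term ℕ, N (nf t)
  | .var k => trivial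
  | .func F ts => by
    have ih := fun k => nf_N (ts k)
    rw [nf]
    change LFun n _ at F
    cases F with
    | f => exact redF_N ih
    | g i => exact redG_N ih
    | e => trivial

lemma nf_upd {m : ℕ} (ts : Fin m → (LLang n).Term ℕ) (i : Fin m) (t : (LLang n).Term ℕ)
    (θ : ℕ → (LLang n).Term ℕ) :
    (fun k => nf ((Function.update ts i t k).subst θ)) =
      Function.update (fun k => nf ((ts k).subst θ)) i (nf (t.subst θ)) := by
  ext k; by_cases h : k = i
  · subst h; simp
  · simp [h]

lemma nf_ehat (θ : ℕ → (LLang n).Term ℕ) : nf ((ehat n).subst θ) = T.e := by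
  simp only [ehat, Term.subst, nf, app]

lemma nf_rw {t t' : (LLang n).Term ℕ} (h : Rw (SigmaLplus n) t t') : nf t = nf t' := by
  induction h with
  | inst hlr θ =>
    have hθ : ∀ k : Fin n, N (nf ((vL n k).subst θ)) := fun k => nf_N _
    rcases hlr with ⟨i, h | h | h | h⟩ | ⟨i, j, hij, h | h⟩
    · obtain ⟨rfl, rfl⟩ := Prod.mk.inj h
      simp only [Term.subst, nf, app, nf_upd, nf_ehat]
      exact eqA i (nf_N _)
    · obtain ⟨rfl, rfl⟩ := Prod.mk.inj h
      simp only [Term.subst, nf, app, nf_upd]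
      exact eqB i hθ
    · obtain ⟨rfl, rfl⟩ := Prod.mk.inj h
      simp only [Term.subst, nf, app, nf_upd]
      exact eqC i hθ
    · obtain ⟨rfl, rfl⟩ := Prod.mk.inj h
      simp only [Term.subst, nf, app, nf_upd, nf_ehat]
      exact eqD i (nf_N _)
    · obtain ⟨rfl, rfl⟩ := Prod.mk.inj h
      simp only [Term.subst, nf, app, nf_upd]
      exact eqE i j hij hθ
    · obtain ⟨rfl, rfl⟩ := Prod.mk.inj h
      simp only [Term.subst, nf, app, nf_upd, nf_ehat]
      exact eqF i j hij (nf_N _)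
  | congr F ts i h ih =>
    simp only [nf]
    congr 1
    ext k; by_cases h : k = i
    · subst h; simp [ih]
    · simp [h]

def emb : T n → (LLang n).Term ℕ
  | .var k => .var k
  | .f a => Term.func (LFun.f : LFun n n) (fun k => emb (a k))
  | .g i a => Term.func (LFun.g i : LFun n n) (fun k => emb (a k))
  | .e => ehat n

local notation "Red" => Relation.ReflTransGen (Rw (SigmaLplus n))

lemma red_one {m : ℕ} (F : (LLang n).Functions m) (ts : Fin m → (LLang n).Term ℕ) (i : Fin m)
    {t : (LLang n).Term ℕ} (h : Red (ts i) t) :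
    Red (Term.func F ts) (Term.func F (Function.update ts i t)) := by
  induction h with
  | refl => rw [Function.update_eq_self]
  | tail _ h ih =>
    rename_i b c _
    refine ih.tail ?_
    have := Rw.congr F (Function.update ts i b) i (t' := c) (R := SigmaLplus n) (by simpa using h)
    simpa using this

lemma red_all {m : ℕ} (F : (LLang n).Functions m) (ts us : Fin m → (LLang n).Term ℕ)
    (h : ∀ k, Red (ts k) (us k)) : Red (Term.func F ts) (Term.func F us) := by
  have key : ∀ s : Finset (Fin m),
      Red (Term.func F ts) (Term.func F (fun k => if k ∈ s then us k else ts k)) := by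
    intro s
    induction s using Finset.induction_on with
    | empty => simpa using Relation.ReflTransGen.refl
    | insert a s ha ih =>
      refine ih.trans ?_
      have := red_one F (fun k => if k ∈ s then us k else ts k) a (t := us a) (by simpa [ha] using h a)
      convert this using 2
      ext k; by_cases hk : k = a
      · subst hk; simp
      · simp [hk]
  simpa using key Finset.univ

lemma vsub (b : Fin n → (LLang n).Term ℕ) (k : Fin n) :
    (vL n k).subst (fun l => if h : l < n then b ⟨l, h⟩ else Term.var 0) = b k := by
  simp [vL, Term.subst]

lemma esub (θ : ℕ → (LLang n).Term ℕ) : (ehat n).subst θ = ehat n := by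
  simp only [ehat, Term.subst]
  congr 1
  ext k; exact k.elim0

lemma sub_upd {m : ℕ} (ts : Fin m → (LLang n).Term ℕ) (i : Fin m) (t : (LLang n).Term ℕ)
    (θ : ℕ → (LLang n).Term ℕ) :
    (fun k => ((Function.update ts i t k).subst θ)) =
      Function.update (fun k => ((ts k).subst θ)) i ((t.subst θ)) := by
  ext k; by_cases h : k = i
  · subst h; simp
  · simp [h]

lemma RF_rw {a : Fin n → T n} {r : T n} (h : RF a r) :
    Rw (SigmaLplus n) (Term.func (LFun.f : LFun n n) (fun k => emb (a k))) (emb r) := by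
  cases h with
  | A i h =>
    have := Rw.inst (R := SigmaLplus n) (l := (rule22 n i).1) (r := (rule22 n i).2)
      (Or.inl ⟨i, Or.inl rfl⟩) (fun _ => emb (a i))
    simp only [rule22, Term.subst, sub_upd, esub] at this
    convert this using 2
    ext k; by_cases hk : k = i
    · subst hk; simp
    · simp [hk, h k hk, emb]
  | B i b h hi =>
    have := Rw.inst (R := SigmaLplus n) (l := (rule23 n i).1) (r := (rule23 n i).2)
      (Or.inl ⟨i, Or.inr (Or.inl rfl)⟩)
      (fun l => if h : l < n then emb (b ⟨l, h⟩) else Term.var 0)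
    simp only [rule23, Term.subst, sub_upd, vsub (fun k => emb (b k))] at this
    convert this using 2
    ext k; by_cases hk : k = i
    · subst hk; simp [hi, emb]
    · simp [hk, h k hk]

lemma RG_rw {i : Fin n} {a : Fin n → T n} {r : T n} (h : RG i a r) :
    Rw (SigmaLplus n) (Term.func (LFun.g i : LFun n n) (fun k => emb (a k))) (emb r) := by
  cases h with
  | C b h hi =>
    have := Rw.inst (R := SigmaLplus n) (l := (rule24 n i).1) (r := (rule24 n i).2)
      (Or.inl ⟨i, Or.inr (Or.inr (Or.inl rfl))⟩)
      (fun l => if h : l < n then emb (b ⟨l, h⟩) else Term.var 0)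
    simp only [rule24, Term.subst, sub_upd, vsub (fun k => emb (b k))] at this
    convert this using 2
    ext k; by_cases hk : k = i
    · subst hk; simp [hi, emb]
    · simp [hk, h k hk]
  | D h =>
    have := Rw.inst (R := SigmaLplus n) (l := (rule29 n i).1) (r := (rule29 n i).2)
      (Or.inl ⟨i, Or.inr (Or.inr (Or.inr rfl))⟩) (fun _ => emb (a i))
    simp only [rule29, Term.subst, sub_upd, esub] at this
    convert this using 2
    ext k; by_cases hk : k = i
    · subst hk; simp
    · simp [hk, h k hk, emb]
  | E j hj b h hi hjj =>
    have := Rw.inst (R := SigmaLplus n) (l := (rule2728 n i j).1) (r := (rule2728 n i j).2)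
      (Or.inr ⟨i, j, hj.symm, Or.inl rfl⟩)
      (fun l => if h : l < n then emb (b ⟨l, h⟩) else Term.var 0)
    simp only [rule2728, Term.subst, sub_upd, vsub (fun k => emb (b k))] at this
    convert this using 2
    ext k; by_cases hk : k = j
    · subst hk; simp [hjj, emb]
    · by_cases hk' : k = i
      · subst hk'; simp [hk, hi]
      · simp [hk, hk', h k hk' hk]
  | F j hj h hi =>
    have := Rw.inst (R := SigmaLplus n) (l := (rule210211 n i j).1) (r := (rule210211 n i j).2)
      (Or.inr ⟨i, j, hj.symm, Or.inr rfl⟩) (fun _ => emb (a i))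
    simp only [rule210211, Term.subst, sub_upd, esub] at this
    have he : emb (T.e : T n) = ehat n := by simp only [emb]
    rw [he]
    convert this using 2
    ext k; by_cases hk : k = j
    · subst hk; simp [hi]
    · by_cases hk' : k = i
      · subst hk'; simp [hk]
      · simp [hk, hk', h k hk' hk, emb]

lemma red_nf : ∀ t : (LLang n).Term ℕ, Red t (emb (nf t))
  | .var k => Relation.ReflTransGen.refl
  | .func F ts => by
    have ih := fun k => red_nf (ts k)
    have h1 := red_all F ts _ ih
    refine h1.trans ?_
    rw [nf]
    change LFun n _ at F
    cases F with
    | f =>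
      simp only [app]
      rcases redF_cases (fun k => nf (ts k)) with h | ⟨_, h⟩
      · exact .single (RF_rw h)
      · rw [h]; exact .refl
    | g i =>
      simp only [app]
      rcases redG_cases i (fun k => nf (ts k)) with h | ⟨_, h⟩
      · exact .single (RG_rw h)
      · rw [h]; exact .refl
    | e =>
      have : (fun k => emb (nf (ts k))) = Fin.elim0 := by ext k; exact k.elim0
      rw [this]; exact .refl

lemma nf_red {t t' : (LLang n).Term ℕ} (h : Red t t') : nf t = nf t' := by
  induction h with
  | refl => rfl
  | tail _ h ih => exact ih.trans (nf_rw h)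

end LoopConf

/-- Lemma 2.6: for n ≥ 2, the system Σ_L⁺(n) is confluent. -/
theorem stmt_19 (n : ℕ) (hn : 2 ≤ n) :
    ∀ t t₁ t₂ : (LLang n).Term ℕ,
      Relation.ReflTransGen (Rw (SigmaLplus n)) t t₁ →
      Relation.ReflTransGen (Rw (SigmaLplus n)) t t₂ →
      ∃ t' : (LLang n).Term ℕ,
        Relation.ReflTransGen (Rw (SigmaLplus n)) t₁ t' ∧
        Relation.ReflTransGen (Rw (SigmaLplus n)) t₂ t' := by
  intro t t₁ t₂ h₁ h₂
  refine ⟨LoopConf.emb (LoopConf.nf t), ?_, ?_⟩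
  · rw [LoopConf.nf_red h₁]; exact LoopConf.red_nf t₁
  · rw [LoopConf.nf_red h₂]; exact LoopConf.red_nf t₂
end
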